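/- arXiv:1909.13259 — 6 statements merged into one kernel-verified Lean document; each statement's English description precedes it below -/
import Mathlib

section
/- The homogeneous polynomial P(ξ,ζ,τ) = a(ξ+ζ)τ² + bτξζ + c(ξ²+ζ²)τ + dξζ(ξ+ζ) satisfies, for all ξ, ζ, τ ∈ ℂ, the identity P(φ₁(ξ,ζ,τ), φ₂(ξ,ζ,τ), φ₃(ξ,ζ,τ)) · τ³ = P(ξ,ζ,τ) · φ₃(ξ,ζ,τ)³; equivalently, the rational function Π = P/τ³ is invariant under the birational map φ of ℂℙ₂. -/
/-- The pencil polynomial `P(ξ,ζ,τ) = a(ξ+ζ)τ² + bτξζ + c(ξ²+ζ²)τ + dξζ(ξ+ζ)`. -/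
noncomputable def pencilP (a b c d ξ ζ τ : ℂ) : ℂ :=
  a * (ξ + ζ) * τ ^ 2 + b * τ * ξ * ζ + c * (ξ ^ 2 + ζ ^ 2) * τ + d * ξ * ζ * (ξ + ζ)

/-- First homogeneous component of the map φ. -/
noncomputable def phi1 (a b c d ξ ζ τ : ℂ) : ℂ :=
  -a * τ ^ 2 - (b * ξ + c * ζ) * τ - d * ξ * (ξ + ζ)

/-- Second homogeneous component of the map φ. -/
noncomputable def phi2 (_a _b c d ξ _ζ τ : ℂ) : ℂ := ξ * (c * τ + d * ξ)

/-- Third homogeneous component of the map φ. -/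
noncomputable def phi3 (_a _b c d ξ _ζ τ : ℂ) : ℂ := τ * (c * τ + d * ξ)

/-- The rational function `Π = P/τ³` is invariant under the birational map φ of ℂℙ₂:
`P(φ₁,φ₂,φ₃)·τ³ = P·φ₃³`. -/
theorem pencil_invariant (a b c d : ℂ) :
    ∀ ξ ζ τ : ℂ,
      pencilP a b c d (phi1 a b c d ξ ζ τ) (phi2 a b c d ξ ζ τ) (phi3 a b c d ξ ζ τ) * τ ^ 3
        = pencilP a b c d ξ ζ τ * (phi3 a b c d ξ ζ τ) ^ 3 := by
  intro ξ ζ τ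
  simp only [pencilP, phi1, phi2, phi3]
  ring
end

section
/- For all (x,y,z,t) ∈ ℂ⁴ and each component index i ∈ {1,2,3,4}, the composition satisfies ψ̃ᵢ(φ̃₁(x,y,z,t), φ̃₂(x,y,z,t), φ̃₃(x,y,z,t), φ̃₄(x,y,z,t)) = (ct + d(x+y))³ · (x,y,z,t)ᵢ, i.e. ψ̃ ∘ φ̃ = B₁³ · id as quadruples of polynomial maps; in particular φ̃ is birational with inverse ψ̃. -/
/-- The inflated map φ̃ on ℂ⁴. -/
noncomputable def phiT (a b c d : ℂ) : ℂ × ℂ × ℂ × ℂ → ℂ × ℂ × ℂ × ℂ :=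
  fun (x, y, z, t) =>
    (-a * t ^ 2 - b * (x + y) * t - c * (x + y + z) * t - d * (x + y) * (2 * x + 2 * y + z),
     x * (c * t + d * (x + y)),
     y * (c * t + d * (x + y)),
     t * (c * t + d * (x + y)))

/-- The linear involution λ(x,y,z,t) = (z,y,x,t). -/
def lamInv : ℂ × ℂ × ℂ × ℂ → ℂ × ℂ × ℂ × ℂ := fun (x, y, z, t) => (z, y, x, t)

/-- The inverse map ψ̃ = λ ∘ φ̃ ∘ λ. -/
noncomputable def psiT (a b c d : ℂ) : ℂ × ℂ × ℂ × ℂ → ℂ × ℂ × ℂ × ℂ :=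
  lamInv ∘ phiT a b c d ∘ lamInv

/-- The exceptional factor B₁(x,y,z,t) = ct + d(x+y). -/
noncomputable def B1 (c d : ℂ) : ℂ × ℂ × ℂ × ℂ → ℂ := fun (x, y, _z, t) => c * t + d * (x + y)

/-- `ψ̃ ∘ φ̃ = B₁³ · id` componentwise: φ̃ is birational with inverse ψ̃. -/
theorem psi_comp_phi (a b c d : ℂ) (p : ℂ × ℂ × ℂ × ℂ) :
    psiT a b c d (phiT a b c d p) = (B1 c d p) ^ 3 • p := by
  obtain ⟨x, y, z, t⟩ := p
  simp only [psiT, phiT, lamInv, B1, Function.comp_apply, Prod.smul_mk, smul_eq_mul, Prod.mk.injEq]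
  refine ⟨?_, ?_, ?_, ?_⟩ <;> ring
end

section
/- For all (x,y,z,t) ∈ ℂ⁴ and each component index i ∈ {1,2,3,4}, the composition satisfies φ̃ᵢ(ψ̃₁(x,y,z,t), ψ̃₂(x,y,z,t), ψ̃₃(x,y,z,t), ψ̃₄(x,y,z,t)) = (ct + d(y+z))³ · (x,y,z,t)ᵢ, i.e. φ̃ ∘ ψ̃ = C₁³ · id as quadruples of polynomial maps. -/
/-- The exceptional factor of the inverse, C₁(x,y,z,t) = ct + d(y+z). -/
noncomputable def C1 (c d : ℂ) : ℂ × ℂ × ℂ × ℂ → ℂ := fun (_x, y, z, t) => c * t + d * (y + z)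

/-- `φ̃ ∘ ψ̃ = C₁³ · id` componentwise. -/
theorem phi_comp_psi (a b c d : ℂ) (p : ℂ × ℂ × ℂ × ℂ) :
    phiT a b c d (psiT a b c d p) = (C1 c d p) ^ 3 • p := by
  obtain ⟨x, y, z, t⟩ := p
  simp only [phiT, psiT, lamInv, C1, Function.comp_apply, Prod.smul_mk, smul_eq_mul, Prod.mk.injEq]
  refine ⟨?_, ?_, ?_, ?_⟩ <;> ring
end

section
/- For all (x,y,z,t) ∈ ℂ⁴ one has the identity P̃(φ̃₁, φ̃₂, φ̃₃, φ̃₄)(x,y,z,t) · t³ = P̃(x,y,z,t) · φ̃₄(x,y,z,t)³; consequently every surface of the pencil Q(k) = {k₀ P̃(x,y,z,t) + k₁ t³ = 0}, (k₀,k₁) ≠ (0,0), is invariant under the map φ̃. -/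
/-- Components of the inflated map φ̃ on ℂ⁴. -/
noncomputable def phiT1 (a b c d x y z t : ℂ) : ℂ :=
  -a * t ^ 2 - b * (x + y) * t - c * (x + y + z) * t - d * (x + y) * (2 * x + 2 * y + z)

noncomputable def phiT2 (_a _b c d x y _z t : ℂ) : ℂ := x * (c * t + d * (x + y))

noncomputable def phiT3 (_a _b c d x y _z t : ℂ) : ℂ := y * (c * t + d * (x + y))

noncomputable def phiT4 (_a _b c d x y _z t : ℂ) : ℂ := t * (c * t + d * (x + y))

/-- The homogeneous cubic P̃ defining the invariant pencil. -/
noncomputable def Ptilde (a b c d x y z t : ℂ) : ℂ :=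
  a * t ^ 2 * (x + 2 * y + z) + b * t * (y + z) * (x + y)
    + c * t * ((x + y) ^ 2 + (y + z) ^ 2) + d * (y + z) * (x + y) * (x + 2 * y + z)

/-- The cubic `P̃` is multiplied by the cube of `c t + d (x + y)` under `φ̃`. -/
theorem Ptilde_phiT (a b c d x y z t : ℂ) :
    Ptilde a b c d (phiT1 a b c d x y z t) (phiT2 a b c d x y z t)
        (phiT3 a b c d x y z t) (phiT4 a b c d x y z t)
      = Ptilde a b c d x y z t * (c * t + d * (x + y)) ^ 3 := by
  unfold Ptilde phiT1 phiT2 phiT3 phiT4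
  ring

/-- `P̃(φ̃)·t³ = P̃·φ̃₄³`; consequently every surface of the pencil
`k₀ P̃ + k₁ t³ = 0`, `(k₀,k₁) ≠ (0,0)`, is invariant under φ̃. -/
theorem pencil_invariant_inflated (a b c d : ℂ) :
    (∀ x y z t : ℂ,
      Ptilde a b c d (phiT1 a b c d x y z t) (phiT2 a b c d x y z t)
          (phiT3 a b c d x y z t) (phiT4 a b c d x y z t) * t ^ 3
        = Ptilde a b c d x y z t * (phiT4 a b c d x y z t) ^ 3) ∧
    (∀ k₀ k₁ : ℂ, (k₀, k₁) ≠ (0, 0) → ∀ x y z t : ℂ,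
      k₀ * Ptilde a b c d x y z t + k₁ * t ^ 3 = 0 →
      k₀ * Ptilde a b c d (phiT1 a b c d x y z t) (phiT2 a b c d x y z t)
          (phiT3 a b c d x y z t) (phiT4 a b c d x y z t)
        + k₁ * (phiT4 a b c d x y z t) ^ 3 = 0) := by
  refine ⟨fun x y z t => ?_, fun k₀ k₁ _ x y z t h => ?_⟩
  · rw [Ptilde_phiT, phiT4]
    ring
  · rw [Ptilde_phiT, phiT4]
    linear_combination (c * t + d * (x + y)) ^ 3 * h
end

section
/- (Lemma 2.) For all (x,y,z,t) ∈ ℂ⁴ and all s ∈ ℂ, the map φ̃ satisfies componentwise φ̃(x+s, y−s, z+s, t) = φ̃(x,y,z,t) − s·B₁(x,y,z,t)·(1,−1,1,0). Consequently φ̃ sends the line Λ(M) through a point M and the point Σ = [1,−1,1,0] onto the line Λ(φ̃(M)) through φ̃(M) and Σ. -/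
/-- The vertex direction Σ = (1,−1,1,0). -/
noncomputable def Sig : ℂ × ℂ × ℂ × ℂ := (1, -1, 1, 0)

/-- Lemma 2: `φ̃(M + sΣ) = φ̃(M) − s·B₁(M)·Σ`; consequently φ̃ sends the line
`Λ(M)` through `M` and `Σ` onto the line `Λ(φ̃(M))` through `φ̃(M)` and `Σ`. -/
theorem line_to_line (a b c d : ℂ) :
    (∀ x y z t s : ℂ,
      phiT a b c d (x + s, y - s, z + s, t)
        = phiT a b c d (x, y, z, t) - (s * B1 c d (x, y, z, t)) • Sig) ∧
    (∀ M : ℂ × ℂ × ℂ × ℂ, ∀ s : ℂ, ∃ s' : ℂ,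
      phiT a b c d (M + s • Sig) = phiT a b c d M + s' • Sig) := by
  have translate : ∀ x y z t s : ℂ,
      phiT a b c d (x + s, y - s, z + s, t)
        = phiT a b c d (x, y, z, t) - (s * B1 c d (x, y, z, t)) • Sig := by
    intro x y z t s
    simp only [phiT, B1, Sig, Prod.smul_mk, Prod.mk_sub_mk, smul_eq_mul, Prod.mk.injEq]
    refine ⟨?_, ?_, ?_, ?_⟩ <;> ring
  refine ⟨translate, ?_⟩
  rintro ⟨x, y, z, t⟩ s
  refine ⟨-(s * B1 c d (x, y, z, t)), ?_⟩
  rw [neg_smul, ← sub_eq_add_neg, ← translate]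
  simp [Sig, sub_eq_add_neg]
end

section
/- Assume c ≠ 0, d ≠ 0 and ad − bc + c² ≠ 0. Then the singular locus of φ̃ is exactly the line Δ = {x+y = 0, t = 0}: for a nonzero point (x,y,z,t) ∈ ℂ⁴, all four components φ̃₁, φ̃₂, φ̃₃, φ̃₄ vanish simultaneously at (x,y,z,t) if and only if x + y = 0 and t = 0. In particular the points S₃ = (2,−2,1,0) and Σ = (1,−1,1,0) are singular points of φ̃. -/
/-- The singular locus of φ̃ is exactly the line `Δ = {x+y = 0, t = 0}`; in
particular `S₃ = (2,−2,1,0)` and `Σ = (1,−1,1,0)` are singular points of φ̃. -/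
theorem singular_locus (a b c d : ℂ) (hc : c ≠ 0) (hd : d ≠ 0)
    (h : a * d - b * c + c ^ 2 ≠ 0) :
    (∀ x y z t : ℂ, (x, y, z, t) ≠ (0, 0, 0, 0) →
      ((phiT1 a b c d x y z t = 0 ∧ phiT2 a b c d x y z t = 0 ∧
        phiT3 a b c d x y z t = 0 ∧ phiT4 a b c d x y z t = 0)
        ↔ (x + y = 0 ∧ t = 0))) ∧
    (phiT1 a b c d 2 (-2) 1 0 = 0 ∧ phiT2 a b c d 2 (-2) 1 0 = 0 ∧
      phiT3 a b c d 2 (-2) 1 0 = 0 ∧ phiT4 a b c d 2 (-2) 1 0 = 0) ∧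
    (phiT1 a b c d 1 (-1) 1 0 = 0 ∧ phiT2 a b c d 1 (-1) 1 0 = 0 ∧
      phiT3 a b c d 1 (-1) 1 0 = 0 ∧ phiT4 a b c d 1 (-1) 1 0 = 0) := by
  refine ⟨fun x y z t _ => ⟨?_, ?_⟩, ?_, ?_⟩
  · simp only [phiT1, phiT2, phiT3, phiT4]
    rintro ⟨h1, h2, h3, h4⟩
    by_cases hL : c * t + d * (x + y) = 0
    · have ht2 : (a * d - b * c + c ^ 2) * t ^ 2 = 0 := by
        linear_combination (-d) * h1 +
          (-b * t + 3 * c * t - d * z - 2 * (c * t + d * (x + y))) * hL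
      have ht : t = 0 := by simpa [h] using ht2
      subst ht
      exact ⟨by simpa [hd] using hL, rfl⟩
    · simp only [mul_eq_zero, hL, or_false] at h2 h3 h4
      simp [h2, h3, h4]
  · rintro ⟨hs, rfl⟩
    simp [phiT1, phiT2, phiT3, phiT4, hs]
  · norm_num [phiT1, phiT2, phiT3, phiT4]
  · norm_num [phiT1, phiT2, phiT3, phiT4]
end
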